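/- Let α ∈ ℝ, α ≠ 0, and set E₁ := −exp(4π/α). If E ∈ ℝ and E < E₁, then for every λ ∈ ℂ\{0} one has d(k_E(λ)) := 1 − (α/(2π))·ln(|Re k_E(λ)| + |Im k_E(λ)|) ≠ 0. Hence the Faddeev generalized scattering data a(k_E(λ)) = b(k_E(λ)) = (2π)⁻²·α/d(k_E(λ)) of the two-dimensional point potential are finite and continuous in λ on all of ℂ\{0} (extending continuously to λ = 0 and λ = ∞). -/

import Mathlib

/-- The principal square root of a real number, viewed in `ℂ`
(so `√E = i√(−E)` for `E < 0`). -/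
noncomputable def sqrtC (E : ℝ) : ℂ := (E : ℂ) ^ (1/2 : ℂ)

/-- The rational parametrization `k_E(λ) = ((λ + λ⁻¹)√E/2, i(λ⁻¹ − λ)√E/2) ∈ ℂ²`
of the fixed-energy surface `{k ∈ ℂ² : k² = E}`. -/
noncomputable def kE (E : ℝ) (lam : ℂ) : ℂ × ℂ :=
  ((lam + lam⁻¹) * sqrtC E / 2, Complex.I * (lam⁻¹ - lam) * sqrtC E / 2)

/-- Euclidean norm `|Re k|` of the componentwise real part of `k ∈ ℂ²`. -/
noncomputable def normRe (k : ℂ × ℂ) : ℝ := Real.sqrt (k.1.re ^ 2 + k.2.re ^ 2)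

/-- Euclidean norm `|Im k|` of the componentwise imaginary part of `k ∈ ℂ²`. -/
noncomputable def normIm (k : ℂ × ℂ) : ℝ := Real.sqrt (k.1.im ^ 2 + k.2.im ^ 2)

/-- The denominator `d(k) = 1 − (α/2π)·ln(|Re k| + |Im k|)` of the Faddeev generalized
scattering data `a(k) = b(k) = (2π)⁻²·α/d(k)` of the 2D point potential of strength `α`. -/
noncomputable def dFad (α : ℝ) (k : ℂ × ℂ) : ℝ :=
  1 - α / (2 * Real.pi) * Real.log (normRe k + normIm k)

theorem sqrtC_sq (E : ℝ) : sqrtC E ^ 2 = (E : ℂ) := by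
  have h := Complex.cpow_nat_inv_pow (E : ℂ) (n := 2) (by norm_num)
  unfold sqrtC
  simpa using h

theorem kE_sq (E : ℝ) (lam : ℂ) (h : lam ≠ 0) :
    (kE E lam).1 ^ 2 + (kE E lam).2 ^ 2 = (E : ℂ) := by
  have e : (kE E lam).1 ^ 2 + (kE E lam).2 ^ 2 =
      ((lam + lam⁻¹) ^ 2 + Complex.I ^ 2 * (lam⁻¹ - lam) ^ 2) / 4 * sqrtC E ^ 2 := by
    simp only [kE]; ring
  rw [e, sqrtC_sq, Complex.I_sq]
  field_simp
  ring

theorem exp_lt_norms (α E : ℝ) (hE : E < -Real.exp (4 * Real.pi / α)) (lam : ℂ) (h : lam ≠ 0) :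
    Real.exp (2 * Real.pi / α) < normRe (kE E lam) + normIm (kE E lam) := by
  have h1 := congrArg Complex.re (kE_sq E lam h)
  simp only [pow_two, Complex.add_re, Complex.mul_re, Complex.ofReal_re] at h1
  have h2 : Real.exp (2 * Real.pi / α) < normIm (kE E lam) := by
    unfold normIm
    apply Real.lt_sqrt_of_sq_lt
    have : Real.exp (2 * Real.pi / α) ^ 2 = Real.exp (4 * Real.pi / α) := by
      rw [← Real.exp_nat_mul]; congr 1; push_cast; ring
    rw [this]
    nlinarith [sq_nonneg (kE E lam).1.re, sq_nonneg (kE E lam).2.re]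
  have h3 : 0 ≤ normRe (kE E lam) := Real.sqrt_nonneg _
  linarith

/-- Let `α ≠ 0`, `E₁ := −exp(4π/α)`. If `E < E₁`, then `d(k_E(λ)) ≠ 0` for every
`λ ∈ ℂ\{0}`; hence the Faddeev generalized scattering data
`a(k_E(λ)) = b(k_E(λ)) = (2π)⁻²·α/d(k_E(λ))` are finite and continuous in `λ`
on all of `ℂ\{0}`. -/
theorem point_potential_data_regular_below_ground_state
    (α : ℝ) (hα : α ≠ 0) (E : ℝ) (hE : E < -Real.exp (4 * Real.pi / α)) :
    (∀ lam : ℂ, lam ≠ 0 → dFad α (kE E lam) ≠ 0) ∧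
    ContinuousOn (fun lam : ℂ => ((2 * Real.pi) ^ 2)⁻¹ * α / dFad α (kE E lam))
      {lam : ℂ | lam ≠ 0} := by
  have key := exp_lt_norms α E hE
  have hd : ∀ lam : ℂ, lam ≠ 0 → dFad α (kE E lam) ≠ 0 := by
    intro lam h h0
    have hk := key lam h
    have hl := (Real.lt_log_iff_exp_lt ((Real.exp_pos _).trans hk)).2 hk
    unfold dFad at h0
    have hpi := Real.pi_ne_zero
    apply hl.ne
    field_simp at h0 ⊢
    linarith
  refine ⟨hd, ?_⟩
  have hinv : ContinuousOn (fun lam : ℂ => lam⁻¹) {lam : ℂ | lam ≠ 0} :=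
    continuousOn_inv₀
  have hkc : ContinuousOn (fun lam : ℂ => kE E lam) {lam : ℂ | lam ≠ 0} := by
    unfold kE
    fun_prop
  have hN : Continuous (fun k : ℂ × ℂ => normRe k + normIm k) := by
    unfold normRe normIm
    fun_prop
  refine ContinuousOn.div continuousOn_const ?_ (fun lam h => hd lam h)
  unfold dFad
  refine continuousOn_const.sub (continuousOn_const.mul ?_)
  exact ContinuousOn.log (hN.comp_continuousOn hkc)
    (fun lam h => ((Real.exp_pos _).trans (key lam h)).ne')
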